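/- Let L ⊆ V^P be an isotropic subspace that does not split off any zero factor nor a Bell Lagrangian as a direct factor. Then A(L) is a solvable compact Lie group; in particular A(L) is a solvable group. -/

import Mathlib

/- Common framework: binary stabilizer codes, local unitary/SO(3) automorphism groups. -/

noncomputable section
open scoped Matrix Real ComplexConjugate
open scoped Classical

namespace Stab

/-- The one-qubit phase space `V = 𝔽₂ ⊕ 𝔽₂`, with first coordinate the `z`-component
and second coordinate the `x`-component. -/
abbrev V : Type := ZMod 2 × ZMod 2

/-- The symplectic form on `V`. -/
def omegaV (u v : V) : ZMod 2 := u.1 * v.2 + u.2 * v.1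

/-- The phase space `V^P` over a set of qubits `P`. -/
abbrev QV (P : Type) := P → V

variable {P : Type} [Fintype P] [DecidableEq P]

/-- The direct-sum symplectic form on `V^P`. -/
def omega (u v : QV P) : ZMod 2 := ∑ p, omegaV (u p) (v p)

/-- A subspace `L ⊆ V^P` is isotropic if `ω` vanishes identically on `L × L`. -/
def Isotropic (L : Submodule (ZMod 2) (QV P)) : Prop := ∀ u ∈ L, ∀ v ∈ L, omega u v = 0

/-- Support of a vector of `V^P`. -/
def supp (v : QV P) : Set P := {p | v p ≠ 0}

/-- The basis vector `z_p`. -/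
def zvec (p : P) : QV P := Pi.single p ((1 : ZMod 2), (0 : ZMod 2))

/-- The basis vector `x_p`. -/
def xvec (p : P) : QV P := Pi.single p ((0 : ZMod 2), (1 : ZMod 2))

/-- Restriction (coordinate projection) of a vector to a subset `S ⊆ P`. -/
def restrTo (S : Set P) (v : QV P) : QV P := fun p => if p ∈ S then v p else 0

/-- The coordinate subspace `V^S ⊆ V^P`. -/
def coordSub (S : Set P) : Submodule (ZMod 2) (QV P) where
  carrier := {v | ∀ p ∉ S, v p = 0}
  add_mem' := by intro a b ha hb p hp; simp [Pi.add_apply, ha p hp, hb p hp]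
  zero_mem' := by intro p _; rfl
  smul_mem' := by intro c a ha p hp; simp [Pi.smul_apply, ha p hp]

/-- `L_S := L ∩ V^S`. -/
def LS (L : Submodule (ZMod 2) (QV P)) (S : Set P) : Submodule (ZMod 2) (QV P) :=
  L ⊓ coordSub S

/-- `L` splits as a direct factor on `S`, i.e. `L = L_S × L_{P∖S}`. -/
def SplitsOn (L : Submodule (ZMod 2) (QV P)) (S : Set P) : Prop :=
  ∀ v ∈ L, restrTo S v ∈ L

/-- `L` splits off a zero factor: on some nonempty `S ⊆ P` all vectors of `L` vanish. -/
def HasZeroFactor (L : Submodule (ZMod 2) (QV P)) : Prop :=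
  ∃ S : Set P, S.Nonempty ∧ ∀ v ∈ L, ∀ p ∈ S, v p = 0

/-- The qubit `p` is trivial: `L` splits off a one-dimensional factor on `{p}`. -/
def TrivialQubit (L : Submodule (ZMod 2) (QV P)) (p : P) : Prop :=
  SplitsOn L {p} ∧ ∃ v ∈ L, v ≠ 0 ∧ supp v ⊆ {p}

/-- `L` splits off a trivial factor. -/
def HasTrivialFactor (L : Submodule (ZMod 2) (QV P)) : Prop :=
  ∃ p : P, TrivialQubit L p

/-- `L` splits off a Bell Lagrangian: an indecomposable Lagrangian direct factor on a
two-element set of qubits (all of whose nonzero vectors have full support `{p, q}`). -/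
def HasBellFactor (L : Submodule (ZMod 2) (QV P)) : Prop :=
  ∃ p q : P, p ≠ q ∧ SplitsOn L {p, q} ∧
    ∃ v ∈ L, ∃ w ∈ L, v ≠ w ∧ supp v = {p, q} ∧ supp w = {p, q} ∧ supp (v + w) = {p, q}

/-- The factor `L_S` (for `S` in a partition) is indecomposable. -/
def IndecompWithin (L : Submodule (ZMod 2) (QV P)) (S : Set P) : Prop :=
  ∀ T ⊆ S, SplitsOn L T → T = ∅ ∨ T = S

/-! ### The Hilbert space, Pauli operators and stabilizer codes -/

/-- The state space `ℋ^{⊗P} = (ℂ²)^{⊗P}`, realised concretely as functions on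
computational basis labels. -/
abbrev HP (P : Type) := (P → Fin 2) → ℂ

/-- Operators on `ℋ^{⊗P}` as matrices. -/
abbrev MatP (P : Type) := Matrix (P → Fin 2) (P → Fin 2) ℂ

/-- The tensor (local) operator `⊗_{p} g_p` on `ℋ^{⊗P}`. -/
def locOp (g : P → Matrix (Fin 2) (Fin 2) ℂ) : MatP P :=
  Matrix.of fun u w => ∏ p, g p (u p) (w p)

def sigmaX : Matrix (Fin 2) (Fin 2) ℂ := !![0, 1; 1, 0]
def sigmaY : Matrix (Fin 2) (Fin 2) ℂ := !![0, -Complex.I; Complex.I, 0]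
def sigmaZ : Matrix (Fin 2) (Fin 2) ℂ := !![1, 0; 0, -1]

/-- The one-qubit Pauli operator `Z^a X^b` attached to `(a, b) ∈ V`. -/
def pauliMat (v : V) : Matrix (Fin 2) (Fin 2) ℂ := sigmaZ ^ (v.1 : ZMod 2).val * sigmaX ^ (v.2 : ZMod 2).val

/-- The Pauli (Weyl) operator attached to `v ∈ V^P`. -/
def Wop (v : QV P) : MatP P := locOp fun p => pauliMat (v p)

/-- A group-homomorphic section `σ` over `L` of the projection from the Pauli group
`Ṽ^P` onto `V^P`: each value `σ(v)` is a unitary scalar multiple of the Pauli operator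
`W(v)`, and `σ` is multiplicative on `L`. -/
structure PauliSection (L : Submodule (ZMod 2) (QV P)) where
  toFun : QV P → MatP P
  scalar : ∀ v : QV P, ∃ c : ℂ, toFun v = c • Wop v
  unitary : ∀ v : QV P, toFun v ∈ Matrix.unitaryGroup (P → Fin 2) ℂ
  mul_of_mem : ∀ u ∈ L, ∀ v ∈ L, toFun (u + v) = toFun u * toFun v
  map_zero : toFun 0 = 1

/-- The stabilizer code `C(L, σ)`: the common fixed-point space of the stabilizer
group `σ(L)`. -/
def code (L : Submodule (ZMod 2) (QV P)) (σ : PauliSection L) : Submodule ℂ (HP P) where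
  carrier := {ψ | ∀ v ∈ L, σ.toFun v *ᵥ ψ = ψ}
  add_mem' := by intro a b ha hb v hv; rw [Matrix.mulVec_add, ha v hv, hb v hv]
  zero_mem' := by intro v hv; simp
  smul_mem' := by intro c a ha v hv; rw [Matrix.mulVec_smul, ha v hv]

/-- The standard section: `σ(v) = W(v)` on `L`. -/
def StandardOn (L : Submodule (ZMod 2) (QV P)) (σ : PauliSection L) : Prop :=
  ∀ v ∈ L, σ.toFun v = Wop v

/-! ### `SO(3)`, rotations, and the automorphism group of a code -/

/-- `3×3` real matrices. -/
abbrev Rot : Type := Matrix (Fin 3) (Fin 3) ℝ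

/-- `SO(3)` as a set of `3×3` real matrices. -/
def SO3 : Set Rot := {A | A * Aᵀ = 1 ∧ A.det = 1}

/-- The ordered Pauli basis (x, y, z) of traceless Hermitian `2×2` matrices. -/
def pauliBasis : Fin 3 → Matrix (Fin 2) (Fin 2) ℂ := ![sigmaX, sigmaY, sigmaZ]

/-- The image of a unitary `u ∈ U(2)` in `SO(3)` under the adjoint action on traceless
Hermitian operators (the identification `U(2)/S¹ = SO(3)`):
`u σ_j u† = Σ_i (adjRot u)_{ij} σ_i`. -/
def adjRot (u : Matrix (Fin 2) (Fin 2) ℂ) : Rot :=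
  Matrix.of fun i j =>
    (1 / 2 : ℝ) * ((pauliBasis i * u * pauliBasis j * u.conjTranspose).trace).re

/-- Rotation about the `x`-axis by angle `θ`. -/
def rotX (θ : ℝ) : Rot := !![1, 0, 0; 0, Real.cos θ, -Real.sin θ; 0, Real.sin θ, Real.cos θ]

/-- Rotation about the `y`-axis by angle `θ`. -/
def rotY (θ : ℝ) : Rot := !![Real.cos θ, 0, Real.sin θ; 0, 1, 0; -Real.sin θ, 0, Real.cos θ]

/-- Rotation about the `z`-axis by angle `θ`. -/
def rotZ (θ : ℝ) : Rot := !![Real.cos θ, -Real.sin θ, 0; Real.sin θ, Real.cos θ, 0; 0, 0, 1]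

/-- The circle group `C_x ⊆ SO(3)` of rotations about the `x`-axis. -/
def Cx : Set Rot := Set.range rotX

/-- The circle group `C_y ⊆ SO(3)` of rotations about the `y`-axis. -/
def Cy : Set Rot := Set.range rotY

/-- The circle group `C_z ⊆ SO(3)` of rotations about the `z`-axis. -/
def Cz : Set Rot := Set.range rotZ

/-- The octahedral group: the subgroup of `SO(3)` generated by the rotations by a right
angle about the three coordinate axes. -/
def octahedral : Set Rot :=
  (Submonoid.closure {rotX (π / 2), rotY (π / 2), rotZ (π / 2)} : Submonoid Rot)

/-- The infinite dihedral group `D_x ⊆ SO(3)`. -/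
def Dx : Set Rot := (Submonoid.closure (Cx ∪ {rotZ π}) : Submonoid Rot)

/-- The infinite dihedral group `D_y ⊆ SO(3)`. -/
def Dy : Set Rot := (Submonoid.closure (Cy ∪ {rotZ π}) : Submonoid Rot)

/-- The infinite dihedral group `D_z ⊆ SO(3)`. -/
def Dz : Set Rot := (Submonoid.closure (Cz ∪ {rotX π}) : Submonoid Rot)

/-- The automorphism group `A(L, σ) ⊆ SO(3)^P` of the stabilizer code `C(L, σ)`:
all families of rotations admitting a local unitary lift mapping the code into itself. -/
def autSet (L : Submodule (ZMod 2) (QV P)) (σ : PauliSection L) : Set (P → Rot) :=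
  {g | ∃ u : P → Matrix (Fin 2) (Fin 2) ℂ,
        (∀ p, u p ∈ Matrix.unitaryGroup (Fin 2) ℂ) ∧
        (∀ p, adjRot (u p) = g p) ∧
        ∀ ψ ∈ code L σ, locOp u *ᵥ ψ ∈ code L σ}

/-- The automorphism group `A(L, σ)_p` at the qubit `p`. -/
def autSetAt (L : Submodule (ZMod 2) (QV P)) (σ : PauliSection L) (p : P) : Set Rot :=
  (fun g => g p) '' autSet L σ

/-- The normal subgroup `Z(L, σ)` of automorphisms acting by a scalar on the code. -/
def zSet (L : Submodule (ZMod 2) (QV P)) (σ : PauliSection L) : Set (P → Rot) :=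
  {g | ∃ u : P → Matrix (Fin 2) (Fin 2) ℂ,
        (∀ p, u p ∈ Matrix.unitaryGroup (Fin 2) ℂ) ∧
        (∀ p, adjRot (u p) = g p) ∧
        ∃ c : ℂ, ∀ ψ ∈ code L σ, locOp u *ᵥ ψ = c • ψ}

/-! ### Restriction to subsets of qubits -/

/-- Restriction of a phase-space vector to the qubits of `S`. -/
def resQV (S : Set P) (v : QV P) : QV ↥S := fun s => v s

/-- Restriction as a linear map. -/
def resLin (S : Set P) : QV P →ₗ[ZMod 2] QV ↥S where
  toFun := resQV S
  map_add' := by intros; rfl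
  map_smul' := by intros; rfl

/-- `L_S`, regarded as a subspace of `V^S`. -/
def LSsub (L : Submodule (ZMod 2) (QV P)) (S : Set P) : Submodule (ZMod 2) (QV ↥S) :=
  Submodule.map (resLin S) (LS L S)

/-- The extension `M ⊗ 1` to `ℋ^{⊗P}` of an operator `M` on `ℋ^{⊗S}`. -/
def extendOp (S : Set P) (M : Matrix (↥S → Fin 2) (↥S → Fin 2) ℂ) : MatP P :=
  Matrix.of fun u w =>
    if ∀ p ∉ S, u p = w p then M (fun s => u s) (fun s => w s) else 0

/-- `σ'` is the restriction `σ|_{L_S}` of the section `σ` to `L_S`. -/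
def RestrictedSection (L : Submodule (ZMod 2) (QV P)) (σ : PauliSection L) (S : Set P)
    (σ' : PauliSection (LSsub L S)) : Prop :=
  ∀ v ∈ LS L S, extendOp S (σ'.toFun (resQV S v)) = σ.toFun v

/-! ### Contiguity, protected and gauge qubits, and normal forms -/

/-- Two qubits are contiguous if they are equal or `L` contains a vector supported
exactly on the pair. -/
def Contig (L : Submodule (ZMod 2) (QV P)) (p q : P) : Prop :=
  p = q ∨ ∃ v ∈ L, supp v = ({p, q} : Set P)

/-- The contiguity class of a qubit. -/
def contigClass (L : Submodule (ZMod 2) (QV P)) (p : P) : Set P := {q | Contig L p q}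

/-- The qubit `p` is protected: the projection `L → V^{{p}}` is surjective. -/
def IsProtected (L : Submodule (ZMod 2) (QV P)) (p : P) : Prop :=
  ∀ w : V, ∃ v ∈ L, v p = w

/-- The qubit `p` is of gauge type: the projection `L → V^{{p}}` has a line as image. -/
def IsGauge (L : Submodule (ZMod 2) (QV P)) (p : P) : Prop :=
  ¬ IsProtected L p ∧ ∃ v ∈ L, v p ≠ 0

/-- The subspace `⟨z_a + z_b : a ≠ b ∈ S⟩`. -/
def zspan (S : Set P) : Submodule (ZMod 2) (QV P) :=
  Submodule.span (ZMod 2) {w | ∃ a ∈ S, ∃ b ∈ S, a ≠ b ∧ w = zvec a + zvec b}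

/-- The vector `Σ_{s ∈ S} x_s`. -/
def xsumOn (S : Set P) : QV P := S.indicator fun _ => ((0 : ZMod 2), (1 : ZMod 2))

/-- Normal form of `L` (conclusion of the normalisation lemma): every contiguity class `S`
carries either `⟨z_a + z_b⟩` or `⟨z_a + z_b⟩ + ⟨Σ_{s∈S} x_s⟩`. -/
def NormalForm (L : Submodule (ZMod 2) (QV P)) : Prop :=
  ∀ p : P,
    LS L (contigClass L p) = zspan (contigClass L p) ∨
    LS L (contigClass L p) =
      zspan (contigClass L p) ⊔ Submodule.span (ZMod 2) {xsumOn (contigClass L p)}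

/-- The pair `(L, σ)` is normalised. -/
def Normalised (L : Submodule (ZMod 2) (QV P)) (σ : PauliSection L) : Prop :=
  NormalForm L ∧
  (∀ p : P, IsGauge L p → contigClass L p = {p} → ∀ v ∈ L, (v p).2 = 0) ∧
  (∀ p : P, IsProtected L p → contigClass L p = {p} →
    connectedComponentIn (autSetAt L σ p) 1 ⊆ Cz) ∧
  (∀ p : P, IsProtected L p → contigClass L p ≠ {p} →
    LS L (contigClass L p) = zspan (contigClass L p) →
    ∃ v ∈ L, ∀ s ∈ contigClass L p, v s = ((0 : ZMod 2), (1 : ZMod 2))) ∧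
  (∀ p q : P, p ≠ q → Contig L p q →
    σ.toFun (zvec p + zvec q) = Wop (zvec p + zvec q))

/-- A local symplectic family of automorphisms of `V`. -/
def IsLocalSymp (f : P → (V ≃ₗ[ZMod 2] V)) : Prop :=
  ∀ (p : P) (u v : V), omegaV (f p u) (f p v) = omegaV u v

/-- The image of `L` under a local (symplectic) transformation. -/
def mapL (L : Submodule (ZMod 2) (QV P)) (f : P → (V ≃ₗ[ZMod 2] V)) :
    Submodule (ZMod 2) (QV P) :=
  Submodule.map (LinearEquiv.piCongrRight f : QV P ≃ₗ[ZMod 2] QV P).toLinearMap L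

/-! ### Abstract group structures carried by subsets of a monoid -/

/-- The set `s` carries the structure of a solvable group. -/
structure SolvableGroupStructure (M : Type) [Monoid M] (s : Set M) where
  G : Type
  [grp : Group G]
  solv : IsSolvable G
  f : G → M
  inj : Function.Injective f
  map_mul : ∀ a b : G, f (a * b) = f a * f b
  range_eq : Set.range f = s

/-- The quotient of the group (carried by) `A` by the normal subgroup (carried by) `Z`
is a compact solvable topological (Lie) group. -/
structure CompactSolvableQuotientStructure (M : Type) [Monoid M] [TopologicalSpace M]
    (A Z : Set M) where
  G : Type
  [grp : Group G]
  [top : TopologicalSpace G]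
  [tgrp : IsTopologicalGroup G]
  cpt : CompactSpace G
  solv : IsSolvable G
  φ : M → G
  cont : ContinuousOn φ A
  map_mul' : ∀ a ∈ A, ∀ b ∈ A, φ (a * b) = φ a * φ b
  surj : ∀ y : G, ∃ a ∈ A, φ a = y
  ker : ∀ a ∈ A, (φ a = 1 ↔ a ∈ Z)

/-! ### Logical qubits and transversally realisable gates -/

/-- The standard hermitian inner product on a finite-dimensional function space. -/
def innerF {ι : Type} [Fintype ι] (ψ φ : ι → ℂ) : ℂ := ∑ i, (starRingEnd ℂ) (ψ i) * φ i

/-- `e` is a unitary identification of the code space with a space of logical qubits. -/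
def IsUnitaryEquiv (L : Submodule (ZMod 2) (QV P)) (σ : PauliSection L) {d : ℕ}
    (e : ↥(code L σ) ≃ₗ[ℂ] HP (Fin d)) : Prop :=
  ∀ ψ φ : ↥(code L σ),
    innerF (e ψ) (e φ) = innerF (ψ : HP P) (φ : HP P)

/-- The operator acting as `w` on the logical qubit `k` and trivially elsewhere. -/
def oneQubitOp (d : ℕ) (k : Fin d) (w : Matrix (Fin 2) (Fin 2) ℂ) : MatP (Fin d) :=
  locOp fun j => if j = k then w else 1

/-- The set of rotations in `SO(3)` induced, via the identification `e`, on a fixed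
logical qubit `k` by (exactly realised) transversal gates, i.e. by elements of `A(L, σ)`. -/
def logicalSet (L : Submodule (ZMod 2) (QV P)) (σ : PauliSection L) {d : ℕ}
    (e : ↥(code L σ) ≃ₗ[ℂ] HP (Fin d)) (k : Fin d) : Set Rot :=
  {A | ∃ w ∈ Matrix.unitaryGroup (Fin 2) ℂ, adjRot w = A ∧
        ∃ u : P → Matrix (Fin 2) (Fin 2) ℂ,
          (∀ p, u p ∈ Matrix.unitaryGroup (Fin 2) ℂ) ∧
          ∀ φ : HP (Fin d),
            locOp u *ᵥ ((e.symm φ : HP P)) = ((e.symm (oneQubitOp d k w *ᵥ φ) : HP P))}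

/-! ### Reed–Muller codes -/

/-- The qubit set `P = 𝔽₂^m ∖ {0}`. -/
abbrev RMQubits (m : ℕ) := {s : Fin m → ZMod 2 // s ≠ 0}

/-- Polynomial functions on `𝔽₂^m` of degree at most `r` with zero constant term. -/
def RMspan (r m : ℕ) : Submodule (ZMod 2) ((Fin m → ZMod 2) → ZMod 2) :=
  Submodule.span (ZMod 2)
    {f | ∃ I : Finset (Fin m), I.Nonempty ∧ I.card ≤ r ∧ f = fun s => ∏ i ∈ I, s i}

/-- The shortened Reed–Muller code `R_*(r, m) ⊆ 𝔽₂^P`. -/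
def RMstar (r m : ℕ) : Submodule (ZMod 2) (RMQubits m → ZMod 2) :=
  Submodule.map (LinearMap.funLeft (ZMod 2) (ZMod 2) Subtype.val) (RMspan r m)

/-- The `z`-part of a phase-space vector. -/
def zPart {P : Type} : QV P →ₗ[ZMod 2] (P → ZMod 2) where
  toFun v := fun p => (v p).1
  map_add' := by intros; rfl
  map_smul' := by intros; rfl

/-- The `x`-part of a phase-space vector. -/
def xPart {P : Type} : QV P →ₗ[ZMod 2] (P → ZMod 2) where
  toFun v := fun p => (v p).2
  map_add' := by intros; rfl
  map_smul' := by intros; rfl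

/-- The Calderbank–Shor–Steane isotropic subspace built from the shortened Reed–Muller
codes `R_*(m−2, m)` (in the `z`-coordinates) and `R_*(1, m)` (in the `x`-coordinates). -/
def cssL (m : ℕ) : Submodule (ZMod 2) (QV (RMQubits m)) :=
  Submodule.comap zPart (RMstar (m - 2) m) ⊓ Submodule.comap xPart (RMstar 1 m)

/-- The stabilizer state `|0⟩_S ⊗ |0⟩_T + |0⟩_S ⊗ |1⟩_T + |1⟩_S ⊗ |0⟩_T − |1⟩_S ⊗ |1⟩_T`
(with `T = Sᶜ`), written in the computational basis. -/
def bellLike (S : Set P) (p q : P) : HP P := fun u =>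
  if (∀ a ∈ S, u a = u p) ∧ (∀ a ∈ Sᶜ, u a = u q) then
    ((-1 : ℂ)) ^ ((u p : Fin 2).val * (u q : Fin 2).val) else 0

/-! ### One-qubit operators -/

/-- The coefficient `tr(W(b)† M W(a) M†)` of the conjugate of `W(a)` by `M`. -/
def pauliCoeff (M : Matrix (Fin 2) (Fin 2) ℂ) (b a : V) : ℂ :=
  ((pauliMat b)ᴴ * (M * pauliMat a * Mᴴ)).trace

lemma pauliMat_zero : pauliMat 0 = 1 := by
  simp [pauliMat]

lemma zmod_two_val_one : (1 : ZMod 2).val = 1 := rfl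

lemma pauliMat_zero_one : pauliMat (0, 1) = !![0, 1; 1, 0] := by
  simp [pauliMat, sigmaX, zmod_two_val_one]

lemma pauliMat_one_zero : pauliMat (1, 0) = !![1, 0; 0, -1] := by
  simp [pauliMat, sigmaZ, zmod_two_val_one]

lemma pauliMat_one_one : pauliMat (1, 1) = !![0, 1; -1, 0] := by
  simp [pauliMat, sigmaX, sigmaZ, zmod_two_val_one]

lemma pauliMat_zero_zero : pauliMat (0, 0) = !![1, 0; 0, 1] := by
  rw [← Matrix.one_fin_two]
  exact pauliMat_zero

lemma V_cases (v : V) : v = (0, 0) ∨ v = (0, 1) ∨ v = (1, 0) ∨ v = (1, 1) := by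
  revert v; decide

lemma pauliMat_expand (M : Matrix (Fin 2) (Fin 2) ℂ) :
    M = ∑ b : V, (((pauliMat b)ᴴ * M).trace / 2) • pauliMat b := by
  have huniv : (Finset.univ : Finset V) = {(0, 0), (0, 1), (1, 0), (1, 1)} := by decide
  rw [huniv]
  ext i j
  fin_cases i <;> fin_cases j <;>
    simp [pauliMat_zero_zero, pauliMat_zero_one, pauliMat_one_zero, pauliMat_one_one,
      Matrix.trace_fin_two, Matrix.mul_apply, Fin.sum_univ_two] <;>
    ring

lemma trace_pauliMat (a : V) : (pauliMat a).trace = if a = 0 then 2 else 0 := by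
  rcases V_cases a with rfl | rfl | rfl | rfl <;>
    simp [pauliMat_zero_zero, pauliMat_zero_one, pauliMat_one_zero, pauliMat_one_one,
      Matrix.trace_fin_two, Prod.ext_iff]
  norm_num

lemma pauliCoeff_one (b a : V) : pauliCoeff 1 b a = if b = a then 2 else 0 := by
  rcases V_cases a with rfl | rfl | rfl | rfl <;> rcases V_cases b with rfl | rfl | rfl | rfl <;>
    simp [pauliCoeff, pauliMat_zero_zero, pauliMat_zero_one, pauliMat_one_zero,
      pauliMat_one_one, Matrix.trace_fin_two, Prod.ext_iff, Matrix.mul_apply, Fin.sum_univ_two] <;>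
    norm_num

lemma pauliMat_unitary (a : V) : pauliMat a ∈ Matrix.unitaryGroup (Fin 2) ℂ := by
  rw [Matrix.mem_unitaryGroup_iff]
  rcases V_cases a with rfl | rfl | rfl | rfl <;> ext i j <;> fin_cases i <;> fin_cases j <;>
    simp [pauliMat_zero_zero, pauliMat_zero_one, pauliMat_one_zero, pauliMat_one_one,
      Matrix.mul_apply, Fin.sum_univ_two, Matrix.star_eq_conjTranspose]

lemma pauliCoeff_zero_right {M : Matrix (Fin 2) (Fin 2) ℂ}
    (hM : M ∈ Matrix.unitaryGroup (Fin 2) ℂ) (b : V) :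
    pauliCoeff M b 0 = if b = 0 then 2 else 0 := by
  rw [Matrix.mem_unitaryGroup_iff, Matrix.star_eq_conjTranspose] at hM
  rw [pauliCoeff, pauliMat_zero, mul_one, hM, mul_one, Matrix.trace_conjTranspose, trace_pauliMat]
  split_ifs <;> simp

lemma pauliCoeff_zero_left {M : Matrix (Fin 2) (Fin 2) ℂ}
    (hM : M ∈ Matrix.unitaryGroup (Fin 2) ℂ) (a : V) :
    pauliCoeff M 0 a = if a = 0 then 2 else 0 := by
  rw [Matrix.mem_unitaryGroup_iff', Matrix.star_eq_conjTranspose] at hM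
  rw [pauliCoeff, pauliMat_zero, Matrix.conjTranspose_one, one_mul, Matrix.trace_mul_comm,
    ← mul_assoc, hM, one_mul, trace_pauliMat]

lemma eq_zero_iff_of_pauliCoeff_ne_zero {M : Matrix (Fin 2) (Fin 2) ℂ}
    (hM : M ∈ Matrix.unitaryGroup (Fin 2) ℂ) {b a : V} (h : pauliCoeff M b a ≠ 0) :
    b = 0 ↔ a = 0 := by
  constructor
  · rintro rfl
    by_contra ha
    exact h (by rw [pauliCoeff_zero_left hM, if_neg ha])
  · rintro rfl
    by_contra hb
    exact h (by rw [pauliCoeff_zero_right hM, if_neg hb])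

lemma exists_pauliCoeff_ne_zero {M : Matrix (Fin 2) (Fin 2) ℂ}
    (hM : M ∈ Matrix.unitaryGroup (Fin 2) ℂ) (a : V) : ∃ b, pauliCoeff M b a ≠ 0 := by
  by_contra! h
  have h1 := pauliMat_expand (M * pauliMat a * Mᴴ)
  have h2 : M * pauliMat a * Mᴴ = 0 := by
    rw [h1]
    refine Finset.sum_eq_zero fun b _ => ?_
    have := h b
    rw [pauliCoeff] at this
    rw [this]; simp
  have h3 : M * pauliMat a * Mᴴ ∈ Matrix.unitaryGroup (Fin 2) ℂ :=
    mul_mem (mul_mem hM (pauliMat_unitary a)) (Unitary.star_mem hM)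
  rw [h2, Matrix.mem_unitaryGroup_iff] at h3
  simp at h3

/-- `M` maps `W(a)` to a multiple of `W(b)` under conjugation. -/
def MapsPauli (M : Matrix (Fin 2) (Fin 2) ℂ) (a b : V) : Prop :=
  ∃ c : ℂ, M * pauliMat a = c • (pauliMat b * M)

lemma mapsPauli_of_pauliCoeff {M : Matrix (Fin 2) (Fin 2) ℂ}
    (hM : M ∈ Matrix.unitaryGroup (Fin 2) ℂ) {a b : V}
    (h : ∀ b' ≠ b, pauliCoeff M b' a = 0) : MapsPauli M a b := by
  have h1 := pauliMat_expand (M * pauliMat a * Mᴴ)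
  rw [Finset.sum_eq_single b] at h1
  · refine ⟨((pauliMat b)ᴴ * (M * pauliMat a * Mᴴ)).trace / 2, ?_⟩
    rw [Matrix.mem_unitaryGroup_iff', Matrix.star_eq_conjTranspose] at hM
    calc M * pauliMat a = (M * pauliMat a * Mᴴ) * M := by rw [mul_assoc, hM, mul_one]
      _ = _ := by rw [← smul_mul_assoc, ← h1]
  · intro b' _ hb'
    have := h b' hb'
    rw [pauliCoeff] at this
    rw [this]; simp
  · simp

lemma conj_pauli_mul {M N : Matrix (Fin 2) (Fin 2) ℂ} {a b e : V} {x y : ℂ}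
    (hN : N * pauliMat a = x • (pauliMat b * N)) (hM : M * pauliMat b = y • (pauliMat e * M)) :
    M * N * pauliMat a = (x * y) • (pauliMat e * (M * N)) := by
  rw [mul_assoc, hN, mul_smul_comm, ← mul_assoc, hM, smul_mul_assoc, mul_assoc, smul_smul]

lemma conj_pauli_scalar_ne_zero {M : Matrix (Fin 2) (Fin 2) ℂ}
    (hM : M ∈ Matrix.unitaryGroup (Fin 2) ℂ) {a b : V} {c : ℂ}
    (h : M * pauliMat a = c • (pauliMat b * M)) : c ≠ 0 := by
  rintro rfl
  have h3 : M * pauliMat a ∈ Matrix.unitaryGroup (Fin 2) ℂ := mul_mem hM (pauliMat_unitary a)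
  rw [h, zero_smul, Matrix.mem_unitaryGroup_iff] at h3
  simp at h3

lemma conj_pauli_star {M : Matrix (Fin 2) (Fin 2) ℂ}
    (hM : M ∈ Matrix.unitaryGroup (Fin 2) ℂ) {a b : V} {c : ℂ}
    (h : M * pauliMat a = c • (pauliMat b * M)) :
    star M * pauliMat b = c⁻¹ • (pauliMat a * star M) := by
  have h0 := conj_pauli_scalar_ne_zero hM h
  have h1 := Matrix.mem_unitaryGroup_iff.1 hM
  have h2 := Matrix.mem_unitaryGroup_iff'.1 hM
  calc star M * pauliMat b = star M * (c⁻¹ • c • (pauliMat b * M)) * star M := by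
        rw [smul_smul, inv_mul_cancel₀ h0, one_smul, ← mul_assoc, mul_assoc, h1, mul_one]
    _ = c⁻¹ • (star M * M * pauliMat a * star M) := by
        rw [← h, mul_smul_comm, smul_mul_assoc, ← mul_assoc]
    _ = _ := by rw [h2, one_mul]

lemma eq_of_pauliMat_eq_smul {a b : V} {c : ℂ} (h : pauliMat a = c • pauliMat b) : a = b := by
  have h1 : pauliCoeff 1 a b * c = 2 := by
    have h2 := pauliCoeff_one a a
    rw [if_pos rfl] at h2
    rw [← h2]
    simp only [pauliCoeff, Matrix.conjTranspose_one, one_mul, mul_one]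
    have h3 : (pauliMat a)ᴴ * pauliMat a = c • ((pauliMat a)ᴴ * pauliMat b) := by
      rw [← mul_smul_comm, ← h]
    rw [h3, Matrix.trace_smul, smul_eq_mul, mul_comm]
  by_contra hab
  rw [pauliCoeff_one, if_neg hab] at h1
  simp at h1

lemma mapsPauli_left_unique {M : Matrix (Fin 2) (Fin 2) ℂ}
    (hM : M ∈ Matrix.unitaryGroup (Fin 2) ℂ) {a a' b : V}
    (h : MapsPauli M a b) (h' : MapsPauli M a' b) : a = a' := by
  obtain ⟨c, hc⟩ := h
  obtain ⟨d, hd⟩ := h'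
  have h0 := conj_pauli_scalar_ne_zero hM hd
  have h2 := Matrix.mem_unitaryGroup_iff'.1 hM
  apply eq_of_pauliMat_eq_smul (c := c * d⁻¹)
  have : M * pauliMat a = M * ((c * d⁻¹) • pauliMat a') := by
    rw [mul_smul_comm, hd, hc, smul_smul, mul_assoc, inv_mul_cancel₀ h0, mul_one]
  calc pauliMat a = star M * (M * pauliMat a) := by rw [← mul_assoc, h2, one_mul]
    _ = _ := by rw [this, ← mul_assoc, h2, one_mul]

/-! ### Solvability of groups of one-qubit unitaries -/

/-- The unitary group `U(2)`. -/
abbrev U2 : Type := Matrix.unitaryGroup (Fin 2) ℂ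

lemma isSolvable_of_chain {G : Type*} [Group G] (K : ℕ → Subgroup G) (n : ℕ)
    (hK : ∀ i < n, ⁅K i, K i⁆ ≤ K (i + 1)) (hn : K n = ⊥) : Group.IsSolvable (K 0) := by
  have key : ∀ i ≤ n, (derivedSeries (K 0) i).map (K 0).subtype ≤ K i := by
    intro i
    induction i with
    | zero =>
      intro _
      rintro _ ⟨x, _, rfl⟩
      exact x.2
    | succ i ih =>
      intro hi
      rw [derivedSeries_succ, Subgroup.map_commutator]
      exact (Subgroup.commutator_mono (ih (by omega)) (ih (by omega))).trans (hK i (by omega))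
  refine ⟨⟨n, ?_⟩⟩
  have h := key n le_rfl
  rw [hn, le_bot_iff] at h
  exact (Subgroup.map_eq_bot_iff_of_injective _ (K 0).subtype_injective).1 h

lemma isSolvable_pi {ι : Type*} [Finite ι] {G : ι → Type*} [∀ i, Group (G i)]
    (h : ∀ i, Group.IsSolvable (G i)) : Group.IsSolvable (∀ i, G i) := by
  choose n hn using fun i => (h i).solvable
  obtain ⟨N, hN⟩ := Finite.exists_le n
  refine ⟨⟨N, ?_⟩⟩
  rw [eq_bot_iff]
  intro x hx
  rw [Subgroup.mem_bot]
  funext i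
  have h1 : Pi.evalMonoidHom G i x ∈ derivedSeries (G i) N :=
    map_derivedSeries_le_derivedSeries (Pi.evalMonoidHom G i) N ⟨x, hx, rfl⟩
  have h2 := derivedSeries_antitone (G i) (hN i) h1
  rw [hn i, Subgroup.mem_bot] at h2
  exact h2

/-- The unitaries permuting the Pauli operators up to scalars by a permutation in `Q`. -/
def permSubgroup (Q : Subgroup (Equiv.Perm V)) : Subgroup U2 where
  carrier := {u | ∃ s ∈ Q, ∀ a, MapsPauli u.1 a (s a)}
  one_mem' := ⟨1, Q.one_mem, fun a => ⟨1, by simp⟩⟩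
  mul_mem' := by
    rintro u v ⟨s, hs, h⟩ ⟨t, ht, h'⟩
    refine ⟨s * t, Q.mul_mem hs ht, fun a => ?_⟩
    obtain ⟨x, hx⟩ := h' a
    obtain ⟨y, hy⟩ := h (t a)
    exact ⟨x * y, conj_pauli_mul hx hy⟩
  inv_mem' := by
    rintro u ⟨s, hs, h⟩
    refine ⟨s⁻¹, Q.inv_mem hs, fun a => ?_⟩
    obtain ⟨x, hx⟩ := h (s⁻¹ a)
    rw [show s (s⁻¹ _) = _ from s.apply_symm_apply _] at hx
    exact ⟨x⁻¹, conj_pauli_star u.2 hx⟩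

/-- The unitaries preserving the line spanned by the Pauli operator `W(a)`. -/
def axisSubgroup (a : V) : Subgroup U2 where
  carrier := {u | MapsPauli u.1 a a}
  one_mem' := ⟨1, by simp⟩
  mul_mem' := by
    rintro u v ⟨x, hx⟩ ⟨y, hy⟩
    exact ⟨y * x, conj_pauli_mul hy hx⟩
  inv_mem' := by
    rintro u ⟨x, hx⟩
    exact ⟨x⁻¹, conj_pauli_star u.2 hx⟩

/-- The unitaries commuting with the Pauli operator `W(a)`. -/
def pauliCentralizer (a : V) : Subgroup U2 where
  carrier := {u | u.1 * pauliMat a = pauliMat a * u.1}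
  one_mem' := by simp
  mul_mem' := by
    intro u v hu hv
    have := conj_pauli_mul (x := 1) (y := 1) (by simpa using hv) (by simpa using hu)
    simpa using this
  inv_mem' := by
    intro u hu
    have := conj_pauli_star u.2 (c := 1) (by simpa using hu)
    simpa using this

open scoped commutatorElement in
lemma commutator_permSubgroup_le (Q : Subgroup (Equiv.Perm V)) :
    ⁅permSubgroup Q, permSubgroup Q⁆ ≤ permSubgroup ⁅Q, Q⁆ := by
  rw [Subgroup.commutator_le]
  rintro u ⟨s, hs, h⟩ v ⟨t, ht, h'⟩
  refine ⟨⁅s, t⁆, Subgroup.commutator_mem_commutator hs ht, ?_⟩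
  intro a
  obtain ⟨w, hw⟩ := h' (t⁻¹ a)
  rw [show t (t⁻¹ _) = _ from t.apply_symm_apply _] at hw
  obtain ⟨x, hx⟩ := h (s⁻¹ (t⁻¹ a))
  rw [show s (s⁻¹ _) = _ from s.apply_symm_apply _] at hx
  obtain ⟨y, hy⟩ := h' (s⁻¹ (t⁻¹ a))
  obtain ⟨z, hz⟩ := h (t (s⁻¹ (t⁻¹ a)))
  exact ⟨_, conj_pauli_mul (conj_pauli_star v.2 hw)
    (conj_pauli_mul (conj_pauli_star u.2 hx) (conj_pauli_mul hy hz))⟩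


open scoped commutatorElement in
lemma commutator_axisSubgroup_le (a : V) :
    ⁅axisSubgroup a, axisSubgroup a⁆ ≤ pauliCentralizer a := by
  rw [Subgroup.commutator_le]
  rintro u ⟨c, hc⟩ v ⟨d, hd⟩
  have h := conj_pauli_mul (conj_pauli_star v.2 hd)
    (conj_pauli_mul (conj_pauli_star u.2 hc) (conj_pauli_mul hd hc))
  have hc0 := conj_pauli_scalar_ne_zero u.2 hc
  have hd0 := conj_pauli_scalar_ne_zero v.2 hd
  rw [show d⁻¹ * (c⁻¹ * (d * c)) = 1 by field_simp, one_smul] at h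
  exact h

lemma mul_comm_of_commute_pauliMat {a : V} (ha : a ≠ 0) {M N : Matrix (Fin 2) (Fin 2) ℂ}
    (hM : M * pauliMat a = pauliMat a * M) (hN : N * pauliMat a = pauliMat a * N) :
    M * N = N * M := by
  have key : ∀ {X Y : Matrix (Fin 2) (Fin 2) ℂ}, X = Y →
      X 0 0 = Y 0 0 ∧ X 0 1 = Y 0 1 ∧ X 1 0 = Y 1 0 ∧ X 1 1 = Y 1 1 := by
    rintro X _ rfl; simp
  have h1 := key hM
  have h2 := key hN
  clear hM hN
  rcases V_cases a with rfl | rfl | rfl | rfl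
  · exact absurd rfl ha
  all_goals
    simp only [pauliMat_zero_one, pauliMat_one_zero, pauliMat_one_one, Matrix.mul_apply,
      Fin.sum_univ_two, Matrix.of_apply, Matrix.cons_val', Matrix.cons_val_zero,
      Matrix.cons_val_one, Matrix.cons_val_fin_one, mul_zero, mul_one, zero_mul, one_mul,
      zero_add, add_zero, mul_neg, neg_mul] at h1 h2
    obtain ⟨a1, a2, a3, a4⟩ := h1
    obtain ⟨b1, b2, b3, b4⟩ := h2
    ext i j
    fin_cases i <;> fin_cases j <;> simp [Matrix.mul_apply, Fin.sum_univ_two] <;> grind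

open scoped commutatorElement in
lemma commutator_pauliCentralizer {a : V} (ha : a ≠ 0) :
    ⁅pauliCentralizer a, pauliCentralizer a⁆ = ⊥ := by
  rw [Subgroup.commutator_eq_bot_iff_le_centralizer]
  intro u hu
  rw [Subgroup.mem_centralizer_iff]
  intro v hv
  exact Subtype.ext (mul_comm_of_commute_pauliMat ha hv hu)

lemma isSolvable_axisSubgroup {a : V} (ha : a ≠ 0) : Group.IsSolvable (axisSubgroup a) := by
  refine isSolvable_of_chain
    (fun | 0 => axisSubgroup a | 1 => pauliCentralizer a | _ => ⊥) 2 (fun i hi => ?_) rfl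
  interval_cases i
  · exact commutator_axisSubgroup_le a
  · exact (commutator_pauliCentralizer ha).le

/-- The permutations of `V` fixing `0`. -/
def fixZero : Subgroup (Equiv.Perm V) := MulAction.stabilizer (Equiv.Perm V) (0 : V)

lemma perm_fin_four_comm : ∀ s : Equiv.Perm (Fin 4), s 0 = 0 ∧ Equiv.Perm.sign s = 1 →
    ∀ t : Equiv.Perm (Fin 4), t 0 = 0 ∧ Equiv.Perm.sign t = 1 → s * t = t * s := by
  decide

lemma exists_equiv_fin_four : ∃ e : V ≃ Fin 4, e 0 = 0 := by
  have e : V ≃ Fin 4 := Fintype.equivFinOfCardEq (by simp)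
  exact ⟨e.trans (Equiv.swap (e 0) 0), by simp⟩

open scoped commutatorElement in
lemma commutator_fixZero_le : ⁅fixZero, fixZero⁆ ≤ fixZero ⊓ Equiv.Perm.sign.ker := by
  rw [Subgroup.commutator_le]
  intro s hs t ht
  refine Subgroup.mem_inf.2
    ⟨mul_mem (mul_mem (mul_mem hs ht) (inv_mem hs)) (inv_mem ht), ?_⟩
  rw [MonoidHom.mem_ker, map_commutatorElement, commutatorElement_eq_one_iff_mul_comm, mul_comm]

open scoped commutatorElement in
lemma commutator_fixZero_sign :
    ⁅fixZero ⊓ Equiv.Perm.sign.ker, fixZero ⊓ Equiv.Perm.sign.ker⁆ = ⊥ := by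
  rw [Subgroup.commutator_eq_bot_iff_le_centralizer]
  rintro s ⟨hs, hs'⟩
  rw [Subgroup.mem_centralizer_iff]
  rintro t ⟨ht, ht'⟩
  obtain ⟨e, he⟩ := exists_equiv_fin_four
  have he' : e.symm 0 = 0 := by rw [← he, e.symm_apply_apply]
  have hs0 : s 0 = 0 := hs
  have ht0 : t 0 = 0 := ht
  have h := perm_fin_four_comm (e.permCongrHom t) ⟨by simp [he', ht0, he], by
    simpa using ht'⟩ (e.permCongrHom s) ⟨by simp [he', hs0, he], by simpa using hs'⟩
  rw [← map_mul, ← map_mul] at h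
  exact e.permCongrHom.injective h

lemma isSolvable_permSubgroup_fixZero : Group.IsSolvable (permSubgroup fixZero) := by
  refine isSolvable_of_chain
    (fun | 0 => permSubgroup fixZero | 1 => permSubgroup (fixZero ⊓ Equiv.Perm.sign.ker)
         | 2 => axisSubgroup (0, 1) | 3 => pauliCentralizer (0, 1) | _ => ⊥) 4
    (fun i hi => ?_) rfl
  have hmono : ∀ {Q Q' : Subgroup (Equiv.Perm V)}, Q ≤ Q' → permSubgroup Q ≤ permSubgroup Q' :=
    fun h u ⟨s, hs, hu⟩ => ⟨s, h hs, hu⟩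
  interval_cases i
  · exact (commutator_permSubgroup_le _).trans (hmono commutator_fixZero_le)
  · refine (commutator_permSubgroup_le _).trans ?_
    rw [commutator_fixZero_sign]
    rintro u ⟨s, hs, hu⟩
    rw [Subgroup.mem_bot] at hs
    subst hs
    exact hu _
  · exact commutator_axisSubgroup_le _
  · exact (commutator_pauliCentralizer (by decide)).le

/-! ### Local operators -/

lemma locOp_mul (g h : P → Matrix (Fin 2) (Fin 2) ℂ) :
    locOp g * locOp h = locOp (fun p => g p * h p) := by
  ext u w
  simp only [locOp, Matrix.mul_apply, Matrix.of_apply, Fintype.prod_sum,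
    Finset.prod_mul_distrib]

omit [DecidableEq P] in
lemma locOp_conjTranspose (g : P → Matrix (Fin 2) (Fin 2) ℂ) :
    (locOp g)ᴴ = locOp (fun p => (g p)ᴴ) := by
  ext u w
  simp [locOp, Matrix.conjTranspose_apply]

lemma trace_locOp (g : P → Matrix (Fin 2) (Fin 2) ℂ) :
    (locOp g).trace = ∏ p, (g p).trace := by
  simp only [locOp, Matrix.trace, Matrix.diag_apply, Matrix.of_apply, Fintype.prod_sum]

omit [DecidableEq P] in
lemma locOp_one : locOp (fun _ : P => (1 : Matrix (Fin 2) (Fin 2) ℂ)) = 1 := by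
  ext u w
  rw [locOp, Matrix.of_apply, Matrix.one_apply]
  split_ifs with h
  · subst h; simp
  · obtain ⟨p, hp⟩ := Function.ne_iff.1 h
    exact Finset.prod_eq_zero (Finset.mem_univ p) (Matrix.one_apply_ne hp)

lemma locOp_unitary {u : P → Matrix (Fin 2) (Fin 2) ℂ}
    (hu : ∀ p, u p ∈ Matrix.unitaryGroup (Fin 2) ℂ) :
    locOp u ∈ Matrix.unitaryGroup (P → Fin 2) ℂ := by
  rw [Matrix.mem_unitaryGroup_iff, Matrix.star_eq_conjTranspose, locOp_conjTranspose, locOp_mul,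
    ← locOp_one]
  congr 1
  funext p
  exact Matrix.mem_unitaryGroup_iff.1 (hu p)

lemma trace_conj_Wop (x : P → Matrix (Fin 2) (Fin 2) ℂ) (w v : QV P) :
    ((Wop w)ᴴ * (locOp x * Wop v * (locOp x)ᴴ)).trace = ∏ p, pauliCoeff (x p) (w p) (v p) := by
  simp only [Wop, locOp_conjTranspose, locOp_mul, trace_locOp, pauliCoeff]

/-! ### The code projector -/

section Projector

variable {L : Submodule (ZMod 2) (QV P)} (σ : PauliSection L)

/-- The sum of the stabilizer group, i.e. `|L|` times the projector onto the code. -/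
def stabSum (σ : PauliSection L) : MatP P := ∑ v : L, σ.toFun v

lemma toFun_mul_stabSum (w : L) : σ.toFun w * stabSum σ = stabSum σ := by
  rw [stabSum, Finset.mul_sum]
  simp only [← σ.mul_of_mem w w.2 _ (Subtype.prop _)]
  exact Fintype.sum_equiv (Equiv.addLeft w) _ _ fun v => rfl

lemma stabSum_mul_self : stabSum σ * stabSum σ = (Fintype.card L : ℂ) • stabSum σ := by
  conv_lhs => lhs; rw [stabSum]
  rw [Finset.sum_mul]
  simp only [toFun_mul_stabSum, Finset.sum_const, Finset.card_univ]
  rw [Nat.cast_smul_eq_nsmul]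

omit [Fintype P] [DecidableEq P] in
lemma QV_add_self (v : QV P) : v + v = 0 := by
  have h : ∀ a : V, a + a = 0 := by decide
  funext p
  exact h (v p)

lemma conjTranspose_toFun (v : L) : (σ.toFun v)ᴴ = σ.toFun v := by
  have h1 : σ.toFun v * σ.toFun v = 1 := by
    rw [← σ.mul_of_mem v v.2 v v.2, QV_add_self, σ.map_zero]
  have h2 := Matrix.mem_unitaryGroup_iff.1 (σ.unitary v)
  rw [Matrix.star_eq_conjTranspose] at h2
  calc (σ.toFun v)ᴴ = σ.toFun v * σ.toFun v * (σ.toFun v)ᴴ := by rw [h1, one_mul]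
    _ = _ := by rw [mul_assoc, h2, mul_one]

lemma conjTranspose_stabSum : (stabSum σ)ᴴ = stabSum σ := by
  rw [stabSum, Matrix.conjTranspose_sum]
  exact Finset.sum_congr rfl fun v _ => conjTranspose_toFun σ v

lemma mem_code_iff (ψ : HP P) :
    ψ ∈ code L σ ↔ stabSum σ *ᵥ ψ = (Fintype.card L : ℂ) • ψ := by
  constructor
  · intro h
    rw [stabSum, Matrix.sum_mulVec, Finset.sum_congr rfl fun v _ => h v.1 v.2]
    simp [Nat.cast_smul_eq_nsmul]
  · intro h v hv
    have hn : (Fintype.card L : ℂ) ≠ 0 := Nat.cast_ne_zero.2 Fintype.card_ne_zero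
    have h2 : σ.toFun v *ᵥ ((Fintype.card L : ℂ) • ψ) = (Fintype.card L : ℂ) • ψ := by
      rw [← h, Matrix.mulVec_mulVec, toFun_mul_stabSum σ ⟨v, hv⟩]
    rw [Matrix.mulVec_smul] at h2
    exact smul_right_injective _ hn h2

lemma stabSum_mulVec_mem_code (ψ : HP P) : stabSum σ *ᵥ ψ ∈ code L σ := by
  intro v hv
  rw [Matrix.mulVec_mulVec, toFun_mul_stabSum σ ⟨v, hv⟩]

open scoped ComplexOrder in
lemma map_code_iff_commute {U : MatP P} (hU : U ∈ Matrix.unitaryGroup (P → Fin 2) ℂ) :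
    (∀ ψ ∈ code L σ, U *ᵥ ψ ∈ code L σ) ↔ U * stabSum σ = stabSum σ * U := by
  have h1 := Matrix.mem_unitaryGroup_iff.1 hU
  have h2 := Matrix.mem_unitaryGroup_iff'.1 hU
  rw [Matrix.star_eq_conjTranspose] at h1 h2
  constructor
  · intro h
    set T := stabSum σ with hT
    set n : ℂ := (Fintype.card L : ℂ) with hn
    have hTT : T * T = n • T := stabSum_mul_self σ
    have hTs : Tᴴ = T := conjTranspose_stabSum σ
    have h3 : T * (U * T) = n • (U * T) := by
      apply Matrix.ext_of_mulVec_single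
      intro i
      rw [← Matrix.mulVec_mulVec, ← Matrix.mulVec_mulVec, Matrix.smul_mulVec,
        ← Matrix.mulVec_mulVec]
      exact (mem_code_iff σ _).1 (h _ (stabSum_mulVec_mem_code σ _))
    set Q := U * T * Uᴴ with hQ
    have hQs : Qᴴ = Q := by
      rw [hQ, Matrix.conjTranspose_mul, Matrix.conjTranspose_mul, hTs,
        Matrix.conjTranspose_conjTranspose, mul_assoc]
    have hTQ : T * Q = n • Q := by
      rw [hQ, ← mul_assoc, h3, smul_mul_assoc]
    have hQQ : Q * Q = n • Q := by
      calc Q * Q = U * T * (Uᴴ * U) * T * Uᴴ := by simp only [hQ, mul_assoc]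
        _ = U * (T * T) * Uᴴ := by rw [h2, mul_one]; simp only [mul_assoc]
        _ = _ := by rw [hTT, mul_smul_comm, smul_mul_assoc]
    have hnc : star n = n := by rw [hn]; simp
    have hQT : Q * T = n • Q := by
      have := congrArg Matrix.conjTranspose hTQ
      rwa [Matrix.conjTranspose_mul, hTs, hQs, Matrix.conjTranspose_smul, hQs, hnc] at this
    have htr : Q.trace = T.trace := by
      rw [hQ, Matrix.trace_mul_comm, ← mul_assoc, h2, one_mul]
    have hzero : ((T - Q)ᴴ * (T - Q)).trace = 0 := by
      rw [Matrix.conjTranspose_sub, hTs, hQs, sub_mul, mul_sub, mul_sub, hTT, hTQ, hQT, hQQ]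
      simp [Matrix.trace_sub, Matrix.trace_smul, htr]
    rw [Matrix.trace_conjTranspose_mul_self_eq_zero_iff, sub_eq_zero] at hzero
    rw [hzero, hQ, mul_assoc _ Uᴴ U, h2, mul_one, ← hQ, ← hzero]
  · intro h ψ hψ
    rw [mem_code_iff] at hψ ⊢
    rw [Matrix.mulVec_mulVec, ← h, ← Matrix.mulVec_mulVec, hψ, Matrix.mulVec_smul]

/-- The scalar relating the section to the Pauli operators. -/
def sectionScalar (σ : PauliSection L) (v : QV P) : ℂ := (σ.scalar v).choose

lemma toFun_eq_smul (v : QV P) : σ.toFun v = sectionScalar σ v • Wop v :=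
  (σ.scalar v).choose_spec

lemma sectionScalar_ne_zero (v : QV P) : sectionScalar σ v ≠ 0 := by
  intro h
  have h1 := toFun_eq_smul σ v
  have h2 := Matrix.mem_unitaryGroup_iff.1 (σ.unitary v)
  rw [h1, h, zero_smul, zero_mul] at h2
  exact zero_ne_one h2

lemma trace_conj_stabSum (x : P → Matrix (Fin 2) (Fin 2) ℂ) (w : QV P) :
    ((Wop w)ᴴ * (locOp x * stabSum σ * (locOp x)ᴴ)).trace =
      ∑ v : L, sectionScalar σ v * ∏ p, pauliCoeff (x p) (w p) ((v : QV P) p) := by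
  rw [stabSum, Finset.mul_sum, Finset.sum_mul, Finset.mul_sum, Matrix.trace_sum]
  refine Finset.sum_congr rfl fun v _ => ?_
  rw [toFun_eq_smul, mul_smul_comm, smul_mul_assoc, mul_smul_comm, Matrix.trace_smul,
    trace_conj_Wop, smul_eq_mul]

/-- If `⊗ u_p` commutes with the code projector, then `⊗ y_p` and `⊗ y_p u_p` conjugate the
projector to operators with the same Pauli coefficients. -/
lemma sum_pauliCoeff_eq {u : P → Matrix (Fin 2) (Fin 2) ℂ}
    (hu : ∀ p, u p ∈ Matrix.unitaryGroup (Fin 2) ℂ)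
    (hcomm : locOp u * stabSum σ = stabSum σ * locOp u)
    (y : P → Matrix (Fin 2) (Fin 2) ℂ) (w : QV P) :
    ∑ v : L, sectionScalar σ v * ∏ p, pauliCoeff (y p * u p) (w p) ((v : QV P) p) =
      ∑ v : L, sectionScalar σ v * ∏ p, pauliCoeff (y p) (w p) ((v : QV P) p) := by
  rw [← trace_conj_stabSum σ (fun p => y p * u p), ← trace_conj_stabSum, ← locOp_mul]
  have h1 := Matrix.mem_unitaryGroup_iff.1 (locOp_unitary hu)
  rw [Matrix.star_eq_conjTranspose] at h1
  have h2 : locOp y * locOp u * stabSum σ * (locOp y * locOp u)ᴴ =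
      locOp y * stabSum σ * (locOp y)ᴴ := by
    rw [mul_assoc (locOp y), hcomm, Matrix.conjTranspose_mul]
    calc _ = locOp y * stabSum σ * (locOp u * (locOp u)ᴴ) * (locOp y)ᴴ := by
          simp only [mul_assoc]
      _ = _ := by rw [h1, mul_one]
  rw [h2]

end Projector

/-! ### Minimal supports -/

lemma V_eq_of_ne {a b c : V} (ha : a ≠ 0) (hb : b ≠ 0) (hab : a ≠ b) (hc : c ≠ 0) :
    c = a ∨ c = b ∨ c = a + b := by
  revert a b c; decide

lemma V_add_eq_zero_iff {a b : V} : a + b = 0 ↔ a = b := by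
  revert a b; decide

lemma omegaV_eq_one {a b : V} (ha : a ≠ 0) (hb : b ≠ 0) (hab : a ≠ b) : omegaV a b = 1 := by
  revert a b; unfold omegaV; decide

lemma V_eq_zero_of_omegaV {a b c : V} (ha : a ≠ 0) (hb : b ≠ 0) (hab : a ≠ b)
    (h1 : omegaV c a = 0) (h2 : omegaV c b = 0) : c = 0 := by
  revert a b c; unfold omegaV; decide

omit [Fintype P] [DecidableEq P] in
lemma mem_supp {v : QV P} {p : P} : p ∈ supp v ↔ v p ≠ 0 := Iff.rfl

omit [DecidableEq P] in
/-- A qubit outside any zero factor supports an element of `L` of minimal support. -/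
lemma exists_minimal_supp {L : Submodule (ZMod 2) (QV P)} (hzero : ¬ HasZeroFactor L) (p : P) :
    ∃ v₀ ∈ L, v₀ p ≠ 0 ∧ ∀ v ∈ L, v p ≠ 0 → supp v ⊆ supp v₀ → supp v = supp v₀ := by
  have hne : {v : QV P | v ∈ L ∧ v p ≠ 0}.Nonempty := by
    by_contra! h
    refine hzero ⟨{p}, Set.singleton_nonempty p, fun v hv q hq => ?_⟩
    rw [Set.mem_singleton_iff] at hq
    subst hq
    by_contra hvq
    exact Set.eq_empty_iff_forall_notMem.1 h v ⟨hv, hvq⟩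
  obtain ⟨v₀, h0, hmin⟩ := Set.exists_min_image _ (fun v : QV P => (supp v).ncard)
    (Set.toFinite _) hne
  exact ⟨v₀, h0.1, h0.2, fun v hv hvp hsub =>
    Set.eq_of_subset_of_ncard_le hsub (hmin v ⟨hv, hvp⟩) (Set.toFinite _)⟩

/-- `L` has a unique value at `p` on vectors of support `supp v`. -/
def AxisAt (L : Submodule (ZMod 2) (QV P)) (p : P) (v : QV P) : Prop :=
  v ∈ L ∧ v p ≠ 0 ∧ ∀ w ∈ L, supp w = supp v → w p = v p

/-- The vectors of `L` with support `S` attain all nonzero values at `p`, and are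
determined by their value at `q`, respectively `r`, where `p, q, r` are distinct. -/
structure SeparatingTriple (L : Submodule (ZMod 2) (QV P)) (S : Set P) (p q r : P) : Prop where
  q_ne : q ≠ p
  r_ne : r ≠ p
  r_ne_q : r ≠ q
  exists_eq : ∀ a : V, a ≠ 0 → ∃ x ∈ L, supp x = S ∧ x p = a
  eq_of_q : ∀ v ∈ L, ∀ w ∈ L, supp v = S → supp w = S → v q = w q → v = w
  eq_of_r : ∀ v ∈ L, ∀ w ∈ L, supp v = S → supp w = S → v r = w r → v = w

lemma exists_axisAt_or_separatingTriple {L : Submodule (ZMod 2) (QV P)} (hL : Isotropic L)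
    (hzero : ¬ HasZeroFactor L) (hbell : ¬ HasBellFactor L) (p : P) :
    (∃ v, AxisAt L p v) ∨ ∃ S q r, SeparatingTriple L S p q r := by
  obtain ⟨v₀, hv₀, hv₀p, hmin⟩ := exists_minimal_supp hzero p
  by_cases hA : ∀ w ∈ L, supp w = supp v₀ → w p = v₀ p
  · exact Or.inl ⟨v₀, hv₀, hv₀p, hA⟩
  right
  push Not at hA
  obtain ⟨w₀, hw₀, hsupp, hwv⟩ := hA
  have hw₀p : w₀ p ≠ 0 := by rw [← mem_supp, hsupp]; exact hv₀p
  have hvw : v₀ + w₀ ∈ L := L.add_mem hv₀ hw₀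
  have hadd : ∀ {v w : QV P}, supp v ⊆ supp v₀ → supp w ⊆ supp v₀ →
      supp (v + w) ⊆ supp v₀ := by
    intro v w h1 h2 s hs
    by_contra hs0
    have hv : v s = 0 := by_contra fun h => hs0 (h1 h)
    have hw : w s = 0 := by_contra fun h => hs0 (h2 h)
    exact hs (by rw [Pi.add_apply, hv, hw, add_zero])
  have hsum : supp (v₀ + w₀) = supp v₀ := by
    refine hmin _ hvw (fun h => hwv ?_) (hadd subset_rfl hsupp.le)
    exact (V_add_eq_zero_iff.1 h).symm
  have hw₀s : ∀ s ∈ supp v₀, w₀ s ≠ 0 := fun s hs => by rw [← mem_supp, hsupp]; exact hs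
  have hne : ∀ s ∈ supp v₀, v₀ s ≠ w₀ s := by
    intro s hs h
    rw [← hsum] at hs
    exact hs (V_add_eq_zero_iff.2 h)
  have hrich : ∀ s ∈ supp v₀, ∀ a : V, a ≠ 0 → ∃ x ∈ L, supp x = supp v₀ ∧ x s = a := by
    intro s hs a ha
    rcases V_eq_of_ne (show v₀ s ≠ 0 from hs) (hw₀s s hs) (hne s hs) ha with h | h | h
    · exact ⟨v₀, hv₀, rfl, h.symm⟩
    · exact ⟨w₀, hw₀, hsupp, h.symm⟩
    · exact ⟨v₀ + w₀, hvw, hsum, h.symm⟩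
  have hfull : ∀ v ∈ L, supp v ⊆ supp v₀ → v ≠ 0 → supp v = supp v₀ := by
    intro v hv hsub hv0
    by_cases hvp : v p ≠ 0
    · exact hmin v hv hvp hsub
    rw [not_not] at hvp
    obtain ⟨s, hs⟩ := Function.ne_iff.1 hv0
    obtain ⟨x, hx, hxs, hxv⟩ := hrich s (hsub hs) (v s) hs
    have h1 : supp (v + x) = supp v₀ := by
      refine hmin _ (L.add_mem hv hx) ?_ (hadd hsub hxs.le)
      rw [Pi.add_apply, hvp, zero_add, ← mem_supp, hxs]
      exact hv₀p
    have h2 : s ∈ supp (v + x) := by rw [h1]; exact hsub hs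
    exact absurd (V_add_eq_zero_iff.2 hxv.symm) h2
  have hsep : ∀ s ∈ supp v₀, ∀ v ∈ L, ∀ w ∈ L, supp v = supp v₀ → supp w = supp v₀ →
      v s = w s → v = w := by
    intro s hs v hv w hw hvs hws h
    by_contra hvw'
    have h1 : v + w ≠ 0 := fun h0 => hvw' (by
      funext t; exact V_add_eq_zero_iff.1 (congrFun h0 t))
    have h2 := hfull _ (L.add_mem hv hw) (hadd hvs.le hws.le) h1
    rw [← h2] at hs
    exact hs (V_add_eq_zero_iff.2 h)
  have hq : ∃ q ∈ supp v₀, q ≠ p := by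
    by_contra! h
    have h1 := hL v₀ hv₀ w₀ hw₀
    rw [omega, Finset.sum_eq_single p, omegaV_eq_one hv₀p hw₀p hwv.symm] at h1
    · exact one_ne_zero h1
    · intro s _ hsp
      have : v₀ s = 0 := by_contra fun hs => hsp (h s hs)
      simp [this, omegaV]
    · simp
  obtain ⟨q, hqS, hqp⟩ := hq
  have hr : ∃ r ∈ supp v₀, r ≠ p ∧ r ≠ q := by
    by_contra! h
    have hS : supp v₀ = {p, q} := by
      ext s
      rw [Set.mem_insert_iff, Set.mem_singleton_iff]
      constructor
      · intro hs
        by_cases hsp : s = p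
        · exact Or.inl hsp
        · exact Or.inr (h s hs hsp)
      · rintro (rfl | rfl)
        · exact hv₀p
        · exact hqS
    have homega : ∀ z ∈ L, z p = 0 → ∀ w ∈ L, supp w = supp v₀ → omegaV (z q) (w q) = 0 := by
      intro z hz hzp w hw hws
      have h1 := hL z hz w hw
      rw [omega, Finset.sum_eq_single q] at h1
      · exact h1
      · intro s _ hsq
        by_cases hsp : s = p
        · subst hsp; simp [hzp, omegaV]
        · have : w s = 0 := by
            by_contra hs
            have : s ∈ supp w := hs
            rw [hws, hS] at this
            rcases this with h | h
            · exact hsp h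
            · exact hsq h
          simp [this, omegaV]
      · simp
    refine hbell ⟨p, q, hqp.symm, ?_, v₀, hv₀, w₀, hw₀, fun h => hwv (by rw [h]), hS,
      hsupp.trans hS, hsum.trans hS⟩
    intro v hv
    obtain ⟨x, hx, hxS, hxp⟩ : ∃ x ∈ L, supp x ⊆ supp v₀ ∧ x p = v p := by
      by_cases hvp : v p = 0
      · exact ⟨0, L.zero_mem, fun s hs => absurd rfl hs, hvp.symm⟩
      · obtain ⟨x, hx, hxS, hxp⟩ := hrich p hv₀p (v p) hvp
        exact ⟨x, hx, hxS.le, hxp⟩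
    have hz : v + x ∈ L := L.add_mem hv hx
    have hzp : (v + x) p = 0 := V_add_eq_zero_iff.2 hxp.symm
    have hzq : (v + x) q = 0 := V_eq_zero_of_omegaV (show v₀ q ≠ 0 from hqS) (hw₀s q hqS)
      (hne q hqS) (homega _ hz hzp _ hv₀ rfl) (homega _ hz hzp _ hw₀ hsupp)
    have : restrTo {p, q} v = x := by
      funext s
      rw [restrTo]
      split_ifs with hs
      · rcases hs with rfl | hs
        · exact hxp.symm
        · rw [Set.mem_singleton_iff] at hs
          subst hs
          exact V_add_eq_zero_iff.1 hzq
      · rw [← hS] at hs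
        by_contra hxs
        exact hs (hxS (Ne.symm hxs))
    rw [this]
    exact hx
  obtain ⟨r, hrS, hrp, hrq⟩ := hr
  exact ⟨supp v₀, q, r, hqp, hrp, hrq, hrich p hv₀p, hsep q hqS, hsep r hrS⟩

/-! ### Local automorphisms at a single qubit -/

section Dichotomy

variable {L : Submodule (ZMod 2) (QV P)} (σ : PauliSection L)
  {u : P → Matrix (Fin 2) (Fin 2) ℂ}

omit [DecidableEq P] in
lemma supp_eq_of_prod_pauliCoeff_ne_zero (hu : ∀ p, u p ∈ Matrix.unitaryGroup (Fin 2) ℂ)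
    {w v : QV P} (h : ∏ p, pauliCoeff (u p) (w p) (v p) ≠ 0) : supp v = supp w := by
  ext s
  rw [Finset.prod_ne_zero_iff] at h
  exact not_congr (eq_zero_iff_of_pauliCoeff_ne_zero (hu s) (h s (Finset.mem_univ s))).symm

omit [DecidableEq P] in
lemma prod_pauliCoeff_one_ne_zero (w : QV P) :
    ∏ p, pauliCoeff (1 : Matrix (Fin 2) (Fin 2) ℂ) (w p) (w p) ≠ 0 := by
  rw [Finset.prod_ne_zero_iff]
  intro s _
  rw [pauliCoeff_one, if_pos rfl]
  exact two_ne_zero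

lemma eq_of_pauliCoeff_one_ne_zero {b a : V} (h : pauliCoeff 1 b a ≠ 0) : b = a := by
  by_contra hab
  exact h (by rw [pauliCoeff_one, if_neg hab])

lemma AxisAt.mapsPauli (hu : ∀ p, u p ∈ Matrix.unitaryGroup (Fin 2) ℂ)
    (hcomm : locOp u * stabSum σ = stabSum σ * locOp u) {p : P} {v₀ : QV P}
    (h : AxisAt L p v₀) : MapsPauli (u p) (v₀ p) (v₀ p) := by
  obtain ⟨hv₀, hv₀p, huniq⟩ := h
  set X : ℂ := ∑ v : L, if supp (v : QV P) = supp v₀ then sectionScalar σ v *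
    ∏ q ∈ Finset.univ.erase p, pauliCoeff (u q) (v₀ q) ((v : QV P) q) else 0 with hX
  have hsupp : ∀ b : V, b ≠ 0 → supp (Function.update v₀ p b) = supp v₀ := by
    intro b hb
    ext s
    rw [mem_supp, mem_supp]
    by_cases hs : s = p
    · subst hs; simp [hb, hv₀p]
    · rw [Function.update_of_ne hs]
  have key : ∀ b : V, b ≠ 0 →
      ∑ v : L, sectionScalar σ v *
        ∏ q, pauliCoeff (u q) (Function.update v₀ p b q) ((v : QV P) q) =
      pauliCoeff (u p) b (v₀ p) * X := by
    intro b hb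
    rw [hX, Finset.mul_sum]
    refine Finset.sum_congr rfl fun v _ => ?_
    split_ifs with hv
    · rw [← Finset.mul_prod_erase _ _ (Finset.mem_univ p), Function.update_self,
        huniq v v.2 hv, mul_left_comm]
      congr 2
      refine Finset.prod_congr rfl fun q hq => ?_
      rw [Function.update_of_ne (Finset.ne_of_mem_erase hq)]
    · rw [mul_zero, mul_eq_zero]
      right
      by_contra hprod
      exact hv ((supp_eq_of_prod_pauliCoeff_ne_zero hu hprod).trans (hsupp b hb))
  have hsum : ∀ w : QV P, ∑ v : L, sectionScalar σ v *
        ∏ q, pauliCoeff (u q) (w q) ((v : QV P) q) =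
      ∑ v : L, sectionScalar σ v * ∏ q, pauliCoeff 1 (w q) ((v : QV P) q) := by
    intro w
    have := sum_pauliCoeff_eq σ hu hcomm (fun _ => 1) w
    simpa only [one_mul] using this
  have hone : ∀ {w v : QV P}, ∏ q, pauliCoeff 1 (w q) (v q) ≠ 0 → v = w := by
    intro w v hprod
    rw [Finset.prod_ne_zero_iff] at hprod
    funext s
    exact (eq_of_pauliCoeff_one_ne_zero (hprod s (Finset.mem_univ s))).symm
  have hX0 : X ≠ 0 := by
    intro h0
    have h1 := key (v₀ p) hv₀p
    rw [h0, mul_zero, Function.update_eq_self, hsum, Finset.sum_eq_single ⟨v₀, hv₀⟩] at h1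
    · exact mul_ne_zero (sectionScalar_ne_zero σ v₀) (prod_pauliCoeff_one_ne_zero v₀) h1
    · intro v _ hv
      rw [mul_eq_zero]
      right
      by_contra hprod
      exact hv (Subtype.ext (hone hprod))
    · simp
  refine mapsPauli_of_pauliCoeff (hu p) fun b hb => ?_
  by_cases hb0 : b = 0
  · rw [hb0, pauliCoeff_zero_left (hu p), if_neg hv₀p]
  have h1 := key b hb0
  rw [hsum, Finset.sum_eq_zero] at h1
  · exact (mul_eq_zero.1 h1.symm).resolve_right hX0
  · intro v _
    rw [mul_eq_zero]
    right
    by_contra hprod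
    have hv := hone hprod
    have h2 := huniq v v.2 (by rw [hv, hsupp b hb0])
    rw [hv, Function.update_self] at h2
    exact hb h2

/-- Transport of an element of `L` along the local unitary, away from the qubit `r`. -/
lemma SeparatingTriple.exists_transport (hu : ∀ p, u p ∈ Matrix.unitaryGroup (Fin 2) ℂ)
    (hcomm : locOp u * stabSum σ = stabSum σ * locOp u) {S : Set P} {p q r : P}
    (h : SeparatingTriple L S p q r) {x w : QV P} (hx : x ∈ L) (hxS : supp x = S)
    (hw : ∀ s ≠ r, pauliCoeff (u s) (w s) (x s) ≠ 0) :
    ∃ v ∈ L, supp v = S ∧ ∀ s ≠ r, v s = w s := by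
  set w' : QV P := Function.update w r (x r) with hw'
  set y : P → Matrix (Fin 2) (Fin 2) ℂ := fun s => if s = r then star (u r) else 1 with hy
  have hyu : ∀ s, y s * u s = if s = r then 1 else u s := by
    intro s
    by_cases hs : s = r
    · subst hs
      simp only [hy, if_true]
      exact Matrix.mem_unitaryGroup_iff'.1 (hu s)
    · simp [hy, hs]
  have hyU : ∀ s, y s ∈ Matrix.unitaryGroup (Fin 2) ℂ := by
    intro s
    by_cases hs : s = r
    · simp only [hy, hs, if_true]; exact Unitary.star_mem (hu r)
    · simp only [hy, hs, if_false]; exact one_mem _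
  have hyuU : ∀ s, y s * u s ∈ Matrix.unitaryGroup (Fin 2) ℂ := fun s => mul_mem (hyU s) (hu s)
  have hxprod : ∏ s, pauliCoeff (y s * u s) (w' s) (x s) ≠ 0 := by
    rw [Finset.prod_ne_zero_iff]
    intro s _
    rw [hyu]
    by_cases hs : s = r
    · subst hs
      rw [if_pos rfl, hw', Function.update_self, pauliCoeff_one, if_pos rfl]
      exact two_ne_zero
    · rw [if_neg hs, hw', Function.update_of_ne hs]
      exact hw s hs
  have hw'S : supp w' = S := (supp_eq_of_prod_pauliCoeff_ne_zero hyuU hxprod).symm.trans hxS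
  have h1 := sum_pauliCoeff_eq σ hu hcomm y w'
  rw [Finset.sum_eq_single ⟨x, hx⟩] at h1
  · have h2 : ∑ v : L, sectionScalar σ v * ∏ s, pauliCoeff (y s) (w' s) ((v : QV P) s) ≠ 0 := by
      rw [← h1]
      exact mul_ne_zero (sectionScalar_ne_zero σ x) hxprod
    obtain ⟨v, _, hv⟩ := Finset.exists_ne_zero_of_sum_ne_zero h2
    have hprod := right_ne_zero_of_mul hv
    refine ⟨v, v.2, (supp_eq_of_prod_pauliCoeff_ne_zero hyU hprod).trans hw'S, fun s hs => ?_⟩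
    have h3 := Finset.prod_ne_zero_iff.1 hprod s (Finset.mem_univ s)
    simp only [hy, if_neg hs] at h3
    rw [← eq_of_pauliCoeff_one_ne_zero h3, hw', Function.update_of_ne hs]
  · intro v _ hv
    rw [mul_eq_zero]
    right
    by_contra hprod
    have hvS := (supp_eq_of_prod_pauliCoeff_ne_zero hyuU hprod).trans hw'S
    have h3 := Finset.prod_ne_zero_iff.1 hprod r (Finset.mem_univ r)
    rw [hyu, if_pos rfl, hw', Function.update_self] at h3
    exact hv (Subtype.ext (h.eq_of_r v v.2 x hx hvS hxS (eq_of_pauliCoeff_one_ne_zero h3).symm))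
  · simp

lemma SeparatingTriple.pauliCoeff_unique (hu : ∀ p, u p ∈ Matrix.unitaryGroup (Fin 2) ℂ)
    (hcomm : locOp u * stabSum σ = stabSum σ * locOp u) {S : Set P} {p q r : P}
    (h : SeparatingTriple L S p q r) {a b b' : V} (ha : a ≠ 0)
    (hb : pauliCoeff (u p) b a ≠ 0) (hb' : pauliCoeff (u p) b' a ≠ 0) : b = b' := by
  obtain ⟨x, hx, hxS, hxp⟩ := h.exists_eq a ha
  choose w hw using fun s => exists_pauliCoeff_ne_zero (hu s) (x s)
  have key : ∀ c, pauliCoeff (u p) c a ≠ 0 → ∃ v ∈ L, supp v = S ∧ v p = c ∧ v q = w q := by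
    intro c hc
    obtain ⟨v, hv, hvS, hvw⟩ := h.exists_transport σ hu hcomm
      (w := Function.update w p c) hx hxS (by
        intro s _
        by_cases hs : s = p
        · subst hs; rwa [Function.update_self, hxp]
        · rw [Function.update_of_ne hs]; exact hw s)
    refine ⟨v, hv, hvS, ?_, ?_⟩
    · rw [hvw p h.r_ne.symm, Function.update_self]
    · rw [hvw q h.r_ne_q.symm, Function.update_of_ne h.q_ne]
  obtain ⟨v, hv, hvS, hvp, hvq⟩ := key b hb
  obtain ⟨v', hv', hvS', hvp', hvq'⟩ := key b' hb'
  rw [← hvp, ← hvp', h.eq_of_q v hv v' hv' hvS hvS' (hvq.trans hvq'.symm)]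

lemma SeparatingTriple.exists_perm (hu : ∀ p, u p ∈ Matrix.unitaryGroup (Fin 2) ℂ)
    (hcomm : locOp u * stabSum σ = stabSum σ * locOp u) {S : Set P} {p q r : P}
    (h : SeparatingTriple L S p q r) : ∃ s ∈ fixZero, ∀ a, MapsPauli (u p) a (s a) := by
  choose f hf using exists_pauliCoeff_ne_zero (hu p)
  have hf0 : f 0 = 0 := (eq_zero_iff_of_pauliCoeff_ne_zero (hu p) (hf 0)).2 rfl
  have hmaps : ∀ a, MapsPauli (u p) a (f a) := by
    intro a
    refine mapsPauli_of_pauliCoeff (hu p) fun b hb => ?_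
    by_contra hne
    by_cases ha : a = 0
    · subst ha
      rw [hf0] at hb
      exact hb ((eq_zero_iff_of_pauliCoeff_ne_zero (hu p) hne).2 rfl)
    · exact hb (h.pauliCoeff_unique σ hu hcomm ha hne (hf a))
  have hinj : Function.Injective f := fun a a' haa' =>
    mapsPauli_left_unique (hu p) (hmaps a) (haa' ▸ hmaps a')
  exact ⟨Equiv.ofBijective f (Finite.injective_iff_bijective.1 hinj), hf0, hmaps⟩

end Dichotomy

/-! ### The adjoint action -/

lemma eq_sum_pauliBasis {H : Matrix (Fin 2) (Fin 2) ℂ} (hH : Hᴴ = H) (htr : H.trace = 0) :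
    H = ∑ k, (((1 / 2 : ℝ) * ((pauliBasis k * H).trace).re : ℝ) : ℂ) • pauliBasis k := by
  have h00 := congrFun (congrFun hH 0) 0
  have h01 := congrFun (congrFun hH 0) 1
  have h11 := congrFun (congrFun hH 1) 1
  rw [Matrix.trace_fin_two] at htr
  simp only [Matrix.conjTranspose_apply, Complex.ext_iff, RCLike.star_def, Complex.conj_re,
    Complex.conj_im, Complex.add_re, Complex.add_im, Complex.zero_re, Complex.zero_im]
    at h00 h01 h11 htr
  obtain ⟨t1, t2⟩ := htr
  obtain ⟨-, c2⟩ := h00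
  obtain ⟨d1, d2⟩ := h01
  obtain ⟨-, e2⟩ := h11
  rw [Fin.sum_univ_three]
  ext i j
  fin_cases i <;> fin_cases j <;> apply Complex.ext <;>
    simp [pauliBasis, sigmaX, sigmaY, sigmaZ, Matrix.trace_fin_two, Matrix.vecMul,
      dotProduct, Fin.sum_univ_two] <;> linarith

lemma pauliBasis_conjTranspose (j : Fin 3) : (pauliBasis j)ᴴ = pauliBasis j := by
  ext i k
  fin_cases j <;> fin_cases i <;> fin_cases k <;> simp [pauliBasis, sigmaX, sigmaY, sigmaZ]

lemma pauliBasis_trace (j : Fin 3) : (pauliBasis j).trace = 0 := by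
  fin_cases j <;> simp [pauliBasis, sigmaX, sigmaY, sigmaZ, Matrix.trace_fin_two]

lemma conj_pauliBasis {v : Matrix (Fin 2) (Fin 2) ℂ} (hv : v ∈ Matrix.unitaryGroup (Fin 2) ℂ)
    (j : Fin 3) : v * pauliBasis j * vᴴ = ∑ k, ((adjRot v k j : ℝ) : ℂ) • pauliBasis k := by
  have h1 := Matrix.mem_unitaryGroup_iff'.1 hv
  rw [Matrix.star_eq_conjTranspose] at h1
  have h2 := eq_sum_pauliBasis (H := v * pauliBasis j * vᴴ)
    (by rw [Matrix.conjTranspose_mul, Matrix.conjTranspose_mul, pauliBasis_conjTranspose,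
      Matrix.conjTranspose_conjTranspose, mul_assoc])
    (by rw [Matrix.trace_mul_comm, ← mul_assoc, h1, one_mul, pauliBasis_trace])
  simpa only [adjRot, Matrix.of_apply, mul_assoc] using h2

lemma adjRot_mul (u : Matrix (Fin 2) (Fin 2) ℂ) {v : Matrix (Fin 2) (Fin 2) ℂ}
    (hv : v ∈ Matrix.unitaryGroup (Fin 2) ℂ) : adjRot (u * v) = adjRot u * adjRot v := by
  ext i j
  rw [Matrix.mul_apply]
  have h1 : pauliBasis i * (u * v) * pauliBasis j * (u * v)ᴴ =
      ∑ k, ((adjRot v k j : ℝ) : ℂ) • (pauliBasis i * u * pauliBasis k * uᴴ) := by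
    calc _ = pauliBasis i * u * (v * pauliBasis j * vᴴ) * uᴴ := by
          rw [Matrix.conjTranspose_mul]; simp only [mul_assoc]
      _ = _ := by
          rw [conj_pauliBasis hv, Finset.mul_sum, Finset.sum_mul]
          simp only [mul_smul_comm, smul_mul_assoc]
  conv_lhs => rw [adjRot, Matrix.of_apply, h1, Matrix.trace_sum, Complex.re_sum, Finset.mul_sum]
  refine Finset.sum_congr rfl fun k _ => ?_
  rw [Matrix.trace_smul, smul_eq_mul, Complex.re_ofReal_mul]
  conv_rhs => lhs; rw [adjRot, Matrix.of_apply]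
  ring

lemma adjRot_one : adjRot 1 = 1 := by
  ext i j
  fin_cases i <;> fin_cases j <;>
    simp [adjRot, pauliBasis, sigmaX, sigmaY, sigmaZ, Matrix.trace_fin_two] <;> norm_num

lemma continuous_adjRot : Continuous adjRot := by
  refine continuous_matrix fun i j => ?_
  exact continuous_const.mul (Complex.continuous_re.comp
    ((((continuous_const.matrix_mul continuous_id).matrix_mul continuous_const).matrix_mul
      continuous_id.matrix_conjTranspose).matrix_trace))

/-! ### The group of local unitary automorphisms -/

section Group

variable {L : Submodule (ZMod 2) (QV P)} (σ : PauliSection L)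

/-- The group of local unitaries preserving the code. -/
def localAut (σ : PauliSection L) : Subgroup (P → U2) where
  carrier := {u | locOp (fun p => (u p : Matrix (Fin 2) (Fin 2) ℂ)) * stabSum σ =
    stabSum σ * locOp (fun p => (u p : Matrix (Fin 2) (Fin 2) ℂ))}
  one_mem' := by
    simp only [Set.mem_setOf_eq, Pi.one_apply, OneMemClass.coe_one, locOp_one, one_mul, mul_one]
  mul_mem' := by
    intro u v hu hv
    simp only [Set.mem_setOf_eq, Pi.mul_apply, Submonoid.coe_mul] at hu hv ⊢
    rw [← locOp_mul, mul_assoc, hv, ← mul_assoc, hu, mul_assoc]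
  inv_mem' := by
    intro u hu
    simp only [Set.mem_setOf_eq] at hu ⊢
    have h1 := congrArg Matrix.conjTranspose hu
    rw [Matrix.conjTranspose_mul, Matrix.conjTranspose_mul, conjTranspose_stabSum,
      locOp_conjTranspose] at h1
    exact h1.symm

lemma isSolvable_localAut (hL : Isotropic L) (hzero : ¬ HasZeroFactor L)
    (hbell : ¬ HasBellFactor L) : Group.IsSolvable (localAut σ) := by
  have hK : ∀ p, ∃ K : Subgroup U2, Group.IsSolvable K ∧ ∀ u ∈ localAut σ, u p ∈ K := by
    intro p
    rcases exists_axisAt_or_separatingTriple hL hzero hbell p with ⟨v, hv⟩ | ⟨S, q, r, h⟩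
    · exact ⟨axisSubgroup (v p), isSolvable_axisSubgroup hv.2.1,
        fun u hu => hv.mapsPauli σ (fun s => (u s).2) hu⟩
    · exact ⟨permSubgroup fixZero, isSolvable_permSubgroup_fixZero,
        fun u hu => h.exists_perm σ (fun s => (u s).2) hu⟩
  choose K hKs hKmem using hK
  have := isSolvable_pi hKs
  let f : localAut σ →* ∀ p, K p :=
    { toFun := fun u p => ⟨u.1 p, hKmem p u.1 u.2⟩
      map_one' := rfl
      map_mul' := fun _ _ => rfl }
  refine Group.isSolvable_of_isSolvable_injective (f := f) fun u v huv => ?_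
  exact Subtype.ext (funext fun p => congrArg Subtype.val (congrFun huv p))

/-- The rotations induced by local unitaries. -/
def localRot (σ : PauliSection L) : localAut σ →* (P → Rot) where
  toFun u p := adjRot (u.1 p)
  map_one' := funext fun _ => adjRot_one
  map_mul' _ v := funext fun p => adjRot_mul _ (v.1 p).2

lemma range_localRot : Set.range (localRot σ) = autSet L σ := by
  ext g
  constructor
  · rintro ⟨u, rfl⟩
    exact ⟨fun p => u.1 p, fun p => (u.1 p).2, fun p => rfl,
      (map_code_iff_commute σ (locOp_unitary fun p => (u.1 p).2)).2 u.2⟩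
  · rintro ⟨u, hu, hg, hcode⟩
    exact ⟨⟨fun p => ⟨u p, hu p⟩, (map_code_iff_commute σ (locOp_unitary hu)).1 hcode⟩,
      funext hg⟩

omit [DecidableEq P] in
lemma continuous_locOp : Continuous (locOp : (P → Matrix (Fin 2) (Fin 2) ℂ) → MatP P) := by
  refine continuous_matrix fun i j => ?_
  exact continuous_finsetProd _ fun p _ => (continuous_apply p).matrix_elem _ _

lemma isCompact_autSet : IsCompact (autSet L σ) := by
  set C : Set (P → Matrix (Fin 2) (Fin 2) ℂ) :=
    {u | (∀ p, u p * (u p)ᴴ = 1) ∧ locOp u * stabSum σ = stabSum σ * locOp u} with hC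
  have himage : autSet L σ = (fun u p => adjRot (u p)) '' C := by
    rw [← range_localRot]
    ext g
    constructor
    · rintro ⟨u, rfl⟩
      exact ⟨fun p => u.1 p, ⟨fun p => Matrix.mem_unitaryGroup_iff.1 (u.1 p).2, u.2⟩, rfl⟩
    · rintro ⟨u, ⟨hu, hcomm⟩, rfl⟩
      exact ⟨⟨fun p => ⟨u p, Matrix.mem_unitaryGroup_iff.2 (hu p)⟩, hcomm⟩, rfl⟩
  have hclosed : IsClosed C := by
    rw [hC, Set.setOf_and, Set.setOf_forall]
    refine IsClosed.inter ?_ ?_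
    · exact isClosed_iInter fun p => isClosed_eq
        ((continuous_apply p).matrix_mul (continuous_apply p).matrix_conjTranspose)
        continuous_const
    · exact isClosed_eq (continuous_locOp.matrix_mul continuous_const)
        (continuous_const.matrix_mul continuous_locOp)
  have hcompact : IsCompact (Set.univ.pi fun _ : P => Set.univ.pi fun _ : Fin 2 =>
      Set.univ.pi fun _ : Fin 2 => Metric.closedBall (0 : ℂ) 1) :=
    isCompact_univ_pi fun _ => isCompact_univ_pi fun _ => isCompact_univ_pi fun _ =>
      isCompact_closedBall 0 1
  have hCc : IsCompact C := by
    refine hcompact.of_isClosed_subset hclosed fun u hu p _ i _ j _ => ?_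
    rw [mem_closedBall_zero_iff]
    exact entry_norm_bound_of_unitary (Matrix.mem_unitaryGroup_iff.2 (hu.1 p)) i j
  rw [himage]
  exact hCc.image (continuous_pi fun p => continuous_adjRot.comp (continuous_apply p))

lemma nonempty_solvableGroupStructure {M : Type} [Monoid M] {G : Type} [Group G]
    (hG : Group.IsSolvable G) (f : G →* M) :
    Nonempty (SolvableGroupStructure M (Set.range f)) := by
  refine ⟨{ G := f.toHomUnits.range
            solv := Group.isSolvable_of_surjective f.toHomUnits.rangeRestrict_surjective
            f := fun u => ((u : Mˣ) : M)
            inj := fun u v h => Subtype.ext (Units.ext h)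
            map_mul := fun _ _ => rfl
            range_eq := ?_ }⟩
  ext m
  constructor
  · rintro ⟨⟨_, g, rfl⟩, rfl⟩
    exact ⟨g, rfl⟩
  · rintro ⟨g, rfl⟩
    exact ⟨⟨_, g, rfl⟩, rfl⟩

end Group

/-- **Corollary (solvability).** Let `L ⊆ V^P` be an isotropic subspace that does not
split off any zero factor nor a Bell Lagrangian. Then `A(L)` is a solvable compact Lie
group; in particular it is a solvable group. -/
theorem autSet_solvable_compact {P : Type} [Fintype P] [DecidableEq P]
    (L : Submodule (ZMod 2) (QV P)) (hL : Isotropic L)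
    (hzero : ¬ HasZeroFactor L) (hbell : ¬ HasBellFactor L)
    (σ : PauliSection L) :
    IsCompact (autSet L σ) ∧
    Nonempty (SolvableGroupStructure (P → Rot) (autSet L σ)) := by
  refine ⟨isCompact_autSet σ, ?_⟩
  rw [← range_localRot]
  exact nonempty_solvableGroupStructure (isSolvable_localAut σ hL hzero hbell) (localRot σ)

end Stab
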